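/- The Young symmetrizer c_λ of a partition λ of n satisfies c_λ·c_λ = hook(λ)·c_λ in the group algebra of S_n, where hook(λ) = n!/f^λ is the product of the hook lengths of λ. -/

import Mathlib

/-- The sorted (weakly decreasing) list of parts of a partition of `n`. -/
def partsList {n : ℕ} (p : n.Partition) : List ℕ := p.parts.sort (· ≥ ·)

/-- The cells `(i, j)` of the Young diagram with row lengths `s`. -/
def cellsOf (s : List ℕ) : Finset (ℕ × ℕ) :=
  ((Finset.range s.length) ×ˢ (Finset.range (s.getD 0 0))).filter
    fun c => c.2 < s.getD c.1 0

/-- The row-preserving subgroup `R_λ` of the permutations of the cells of the diagram. -/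
def rowGroup (s : List ℕ) : Finset (Equiv.Perm {c : ℕ × ℕ // c ∈ cellsOf s}) :=
  Finset.univ.filter fun π => ∀ c, ((π c : ℕ × ℕ)).1 = (c : ℕ × ℕ).1

/-- The column-preserving subgroup `C_λ` of the permutations of the cells of the diagram. -/
def colGroup (s : List ℕ) : Finset (Equiv.Perm {c : ℕ × ℕ // c ∈ cellsOf s}) :=
  Finset.univ.filter fun π => ∀ c, ((π c : ℕ × ℕ)).2 = (c : ℕ × ℕ).2

/-- The Young symmetrizer `c_λ = Σ_{π ∈ R_λ, σ ∈ C_λ} sgn(σ) · σπ` in the complex group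
algebra of the symmetric group on the cells of the diagram. -/
noncomputable def youngSymmetrizer (s : List ℕ) :
    MonoidAlgebra ℂ (Equiv.Perm {c : ℕ × ℕ // c ∈ cellsOf s}) :=
  ∑ σ ∈ colGroup s, ∑ π ∈ rowGroup s,
    ((Equiv.Perm.sign σ : ℤ) : ℂ) • MonoidAlgebra.single (σ * π) (1 : ℂ)

/-- The product of the hook lengths of the diagram with row lengths `s`: the hook length of
the cell `(i,j)` is `λ_i + λ̃_j − i − j − 1`. -/
def hookProd (s : List ℕ) : ℕ :=
  ∏ c ∈ cellsOf s, (s.getD c.1 0 + (s.filter fun p => c.2 < p).length - c.1 - c.2 - 1)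

open MvPolynomial in
/-- The Fischer bilinear form on polynomials, `⟨p, q⟩ = p(∂) q` evaluated at `0`. -/
noncomputable def fischer {σ : Type*} :
    MvPolynomial σ ℂ →ₗ[ℂ] MvPolynomial σ ℂ →ₗ[ℂ] ℂ :=
  (basisMonomials σ ℂ).constr ℂ fun m =>
    ((m.prod fun _ k => k.factorial : ℕ) : ℂ) • lcoeff ℂ m

open MvPolynomial in
theorem fischer_monomial_left {σ : Type*} (m : σ →₀ ℕ) (q : MvPolynomial σ ℂ) :
    fischer (monomial m 1) q = ((m.prod fun _ k => k.factorial : ℕ) : ℂ) * coeff m q := by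
  have := (basisMonomials σ ℂ).constr_basis ℂ
    (fun m => ((m.prod fun _ k => k.factorial : ℕ) : ℂ) • lcoeff ℂ m) m
  rw [coe_basisMonomials] at this
  rw [fischer, this]
  simp [lcoeff]

open MvPolynomial in
theorem fischer_X_mul {σ : Type*} (i : σ) (p q : MvPolynomial σ ℂ) :
    fischer (X i * p) q = fischer p (pderiv i q) := by
  classical
  suffices fischer.comp (LinearMap.mulLeft ℂ (X i)) =
      fischer.compl₂ (pderiv i : Derivation ℂ _ _).toLinearMap by
    simpa using DFunLike.congr_fun (DFunLike.congr_fun this p) q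
  refine (basisMonomials σ ℂ).ext fun m => LinearMap.ext fun q => ?_
  have hm : (X i : MvPolynomial σ ℂ) * monomial m 1 = monomial (m + Finsupp.single i 1) 1 := by
    rw [X, monomial_mul, add_comm, one_mul]
  simp only [coe_basisMonomials, LinearMap.comp_apply, LinearMap.mulLeft_apply, hm,
    LinearMap.compl₂_apply]
  rw [fischer_monomial_left]
  erw [fischer_monomial_left]
  erw [coeff_pderiv]
  have : ((m + Finsupp.single i 1).prod fun _ k => k.factorial)
      = (m.prod fun _ k => k.factorial) * (m i + 1) := by
    have h1 := Finsupp.mul_prod_erase' m i (fun _ k => k.factorial) (by simp)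
    have h2 := Finsupp.mul_prod_erase' (m + Finsupp.single i 1) i
      (fun _ k => k.factorial) (by simp)
    rw [← h1, ← h2]
    simp [Finsupp.erase_add, Nat.factorial_succ]
    ring
  rw [this]
  push_cast
  ring

theorem exists_perm_comp_eq {ι α : Type*} [Fintype ι] [DecidableEq α] (u v : ι → α)
    (h : ∀ a, Fintype.card {c // u c = a} = Fintype.card {c // v c = a}) :
    ∃ τ : Equiv.Perm ι, ∀ c, u (τ c) = v c := by
  let e a := (Fintype.card_eq.mp (h a)).some
  refine ⟨(Equiv.sigmaFiberEquiv v).symm.trans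
    ((Equiv.sigmaCongrRight fun a => (e a).symm).trans (Equiv.sigmaFiberEquiv u)), fun c => ?_⟩
  exact ((e (v c)).symm ⟨c, rfl⟩).2

open MvPolynomial in
theorem fischer_prod_X {ι α : Type*} [Fintype ι] [DecidableEq ι] [DecidableEq α] (u v : ι → α) :
    fischer (∏ c, X (u c)) (∏ c, X (v c))
      = ((Finset.univ.filter fun τ : Equiv.Perm ι => ∀ c, u (τ c) = v c).card : ℂ) := by
  have key : ∀ w : ι → α, (∏ c, X (w c) : MvPolynomial α ℂ)
      = monomial (∑ c, Finsupp.single (w c) 1) 1 := by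
    intro w
    rw [monomial_sum_one]
    rfl
  have val : ∀ (w : ι → α) a, (∑ c, Finsupp.single (w c) 1 : α →₀ ℕ) a
      = Fintype.card {c // w c = a} := by
    intro w a
    simp [Finsupp.finsetSum_apply, Finsupp.single_apply, Fintype.card_subtype]
  rw [key, key, fischer_monomial_left, coeff_monomial]
  by_cases h : ∀ a, Fintype.card {c // u c = a} = Fintype.card {c // v c = a}
  · obtain ⟨τ₀, hτ₀⟩ := exists_perm_comp_eq u v h
    rw [if_pos (by ext a; rw [val, val, h]), mul_one]
    congr 1
    have hsupp : (∑ c, Finsupp.single (u c) 1 : α →₀ ℕ).support = Finset.univ.image v := by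
      ext a
      rw [Finsupp.mem_support_iff, val, h, ← Nat.pos_iff_ne_zero, Fintype.card_pos_iff]
      simp
    simp only [Finsupp.prod, hsupp, val, h]
    rw [← DomMulAct.stabilizer_card' v, Fintype.card_subtype]
    refine Finset.card_bij (fun g _ => τ₀ * g) ?_ (fun _ _ _ _ h => mul_left_cancel h) ?_
    · intro g hg
      simp only [Finset.mem_filter_univ, _root_.funext_iff, Function.comp_apply] at hg ⊢
      intro c
      rw [Equiv.Perm.mul_apply, hτ₀, hg]
    · intro τ hτ
      refine ⟨τ₀⁻¹ * τ, ?_, mul_inv_cancel_left _ _⟩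
      simp only [Finset.mem_filter_univ, _root_.funext_iff, Function.comp_apply] at hτ ⊢
      intro c
      rw [← hτ₀, Equiv.Perm.mul_apply, Equiv.Perm.inv_def, Equiv.apply_symm_apply, hτ]
  · rw [if_neg, mul_zero, Finset.filter_false_of_mem, Finset.card_empty, Nat.cast_zero]
    · intro τ _ hτ
      exact h fun a => (Fintype.card_congr (τ.subtypeEquiv fun c => by rw [hτ])).symm
    · intro heq
      exact h fun a => by rw [← val, ← val, heq]

theorem derivation_prod {R A ι : Type*} [CommRing R] [CommRing A] [Algebra R A] [DecidableEq ι]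
    (D : Derivation R A A) (s : Finset ι) (f : ι → A) :
    D (∏ i ∈ s, f i) = ∑ k ∈ s, D (f k) * ∏ i ∈ s.erase k, f i := by
  induction s using Finset.induction_on with
  | empty => simp
  | insert a s ha ih =>
    rw [Finset.prod_insert ha, D.leibniz, ih, Finset.sum_insert ha, Finset.erase_insert ha,
      smul_eq_mul, smul_eq_mul, mul_comm _ (D (f a)), Finset.mul_sum, add_comm]
    congr 1
    refine Finset.sum_congr rfl fun k hk => ?_
    rw [Finset.erase_insert_of_ne (by rintro rfl; exact ha hk), Finset.prod_insert (by simp [ha])]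
    ring

theorem derivation_det {R A ι : Type*} [CommRing R] [CommRing A] [Algebra R A] [DecidableEq ι]
    [Fintype ι] (D : Derivation R A A) (M : Matrix ι ι A) :
    D M.det = ∑ k, (M.updateCol k fun i => D (M i k)).det := by
  simp only [Matrix.det_apply', map_sum, D.leibniz]
  rw [Finset.sum_comm]
  refine Finset.sum_congr rfl fun τ _ => ?_
  rw [D.map_intCast, smul_zero, add_zero, derivation_prod, smul_eq_mul, Finset.mul_sum]
  refine Finset.sum_congr rfl fun k _ => ?_
  rw [← Finset.mul_prod_erase _ _ (Finset.mem_univ k), Matrix.updateCol_self]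
  congr 2
  refine Finset.prod_congr rfl fun i hi => ?_
  rw [Matrix.updateCol_ne (Finset.ne_of_mem_erase hi)]

/-- The minor of the generic matrix with rows `b` and the first `r` columns. -/
noncomputable def genMinor {r : ℕ} (b : Fin r → ℕ) : MvPolynomial (ℕ × ℕ) ℂ :=
  (Matrix.of fun i j : Fin r => (MvPolynomial.X (b i, (j : ℕ)) : MvPolynomial (ℕ × ℕ) ℂ)).det

/-- The polarization operator replacing column `r` by column `p`, on the first `m` rows. -/
noncomputable def polarization (m p r : ℕ) :
    Derivation ℂ (MvPolynomial (ℕ × ℕ) ℂ) (MvPolynomial (ℕ × ℕ) ℂ) :=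
  ∑ a ∈ Finset.range m, (MvPolynomial.X (a, p) : MvPolynomial (ℕ × ℕ) ℂ) •
    MvPolynomial.pderiv (a, r)

open MvPolynomial in
theorem polarization_apply (m p r : ℕ) (f : MvPolynomial (ℕ × ℕ) ℂ) :
    polarization m p r f = ∑ a ∈ Finset.range m, X (a, p) * pderiv (a, r) f := by
  rw [polarization]
  induction Finset.range m using Finset.induction_on with
  | empty => simp
  | insert a s ha ih => simp [Finset.sum_insert ha, ih]

open MvPolynomial in
theorem polarization_X (m p r i k : ℕ) (hi : i < m) :
    polarization m p r (X (i, k)) = if k = r then X (i, p) else 0 := by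
  rw [polarization_apply]
  rw [Finset.sum_eq_single i]
  · by_cases h : k = r
    · simp [h]
    · rw [pderiv_X_of_ne (by simp [h]), mul_zero, if_neg h]
  · intro a _ ha
    rw [pderiv_X_of_ne (by simp [ha.symm]), mul_zero]
  · simp [hi]

/-- The leading principal minor of size `r`. -/
noncomputable def leadingMinor (r : ℕ) : MvPolynomial (ℕ × ℕ) ℂ :=
  genMinor fun i : Fin r => (i : ℕ)

open MvPolynomial in
theorem polarization_leadingMinor {m p r h : ℕ} (hm : h ≤ m) (hpr : p ≤ r) :
    polarization m p r (leadingMinor h) = if p = r ∧ r < h then leadingMinor h else 0 := by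
  rw [leadingMinor, genMinor, derivation_det]
  have hcol : ∀ k : Fin h, (fun i : Fin h => polarization m p r
      ((Matrix.of fun i j : Fin h => (X ((i : ℕ), (j : ℕ)) : MvPolynomial (ℕ × ℕ) ℂ)) i k))
      = fun i : Fin h => if (k : ℕ) = r then X ((i : ℕ), p) else 0 := fun k => by
    funext i
    exact polarization_X _ _ _ _ _ (i.2.trans_le hm)
  simp only [hcol]
  by_cases hr : r < h
  · rw [Finset.sum_eq_single ⟨r, hr⟩]
    · simp only [if_true, hr, and_true]
      by_cases hp : p = r
      · subst hp
        rw [if_pos rfl]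
        congr 1
        ext i j : 2
        by_cases hj : j = ⟨p, hr⟩
        · subst hj; simp
        · rw [Matrix.updateCol_ne hj]
      · rw [if_neg hp]
        have hne : (⟨p, hpr.trans_lt hr⟩ : Fin h) ≠ ⟨r, hr⟩ := by simpa using hp
        refine Matrix.det_zero_of_column_eq hne fun i => ?_
        rw [Matrix.updateCol_ne hne, Matrix.updateCol_self, Matrix.of_apply]
    · intro k _ hk
      refine Matrix.det_eq_zero_of_column_eq_zero k fun i => ?_
      rw [Matrix.updateCol_self, if_neg fun h => hk (Fin.ext h)]
    · simp
  · rw [if_neg (by simp [hr])]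
    refine Finset.sum_eq_zero fun k _ => Matrix.det_eq_zero_of_column_eq_zero k fun i => ?_
    rw [Matrix.updateCol_self, if_neg (by omega)]

theorem genMinor_eq_zero {r : ℕ} {b : Fin r → ℕ} (hb : ¬ Function.Injective b) :
    genMinor b = 0 := by
  rw [Function.not_injective_iff] at hb
  obtain ⟨i, j, h, hij⟩ := hb
  exact Matrix.det_zero_of_row_eq hij (by ext k; simp [h])

open MvPolynomial in
theorem genMinor_snoc {r : ℕ} (b : Fin r → ℕ) (a : ℕ) :
    genMinor (Fin.snoc b a : Fin (r + 1) → ℕ) = ∑ j : Fin (r + 1), (-1) ^ (r + j : ℕ) *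
      X (a, (j : ℕ)) * (Matrix.of fun i k : Fin r =>
        (X (b i, (j.succAbove k : ℕ)) : MvPolynomial (ℕ × ℕ) ℂ)).det := by
  rw [genMinor, Matrix.det_succ_row _ (Fin.last r)]
  refine Finset.sum_congr rfl fun j _ => ?_
  congr 2
  · simp
  · ext i k : 2
    simp

open MvPolynomial in
theorem sum_genMinor_snoc_mul_pderiv {m r : ℕ} (b : Fin r → ℕ) (g : MvPolynomial (ℕ × ℕ) ℂ)
    (μ : ℂ) (h0 : ∀ p < r, polarization m p r g = 0) (h1 : polarization m r r g = μ • g) :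
    ∑ a ∈ Finset.range m, genMinor (Fin.snoc b a : Fin (r + 1) → ℕ) * pderiv (a, r) g
      = μ • (g * genMinor b) := by
  have : ∑ a ∈ Finset.range m, genMinor (Fin.snoc b a : Fin (r + 1) → ℕ) * pderiv (a, r) g
      = ∑ j : Fin (r + 1), (-1) ^ (r + j : ℕ) * (Matrix.of fun i k : Fin r =>
        (X (b i, (j.succAbove k : ℕ)) : MvPolynomial (ℕ × ℕ) ℂ)).det * polarization m j r g := by
    simp only [genMinor_snoc, polarization_apply, Finset.sum_mul, Finset.mul_sum]
    rw [Finset.sum_comm]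
    refine Finset.sum_congr rfl fun j _ => Finset.sum_congr rfl fun a _ => ?_
    ring
  rw [this, Fin.sum_univ_castSucc, Finset.sum_eq_zero, zero_add]
  · simp only [Fin.val_last, h1, Fin.succAbove_last, Fin.val_castSucc]
    rw [← two_mul, pow_mul, neg_one_sq, one_pow, one_mul, mul_smul_comm, mul_comm, genMinor]
  · intro j _
    rw [h0 _ (by simp), mul_zero]

open MvPolynomial in
theorem pderiv_genMinor_snoc {r : ℕ} (b : Fin r → ℕ) (a : ℕ) :
    pderiv (a, r) (genMinor (Fin.snoc b a : Fin (r + 1) → ℕ))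
      = if a ∈ Finset.univ.image b then 0 else genMinor b := by
  split_ifs with h
  · rw [genMinor_eq_zero, map_zero]
    obtain ⟨i, -, hi⟩ := Finset.mem_image.mp h
    intro hinj
    have := @hinj i.castSucc (Fin.last r) (by simp [hi])
    exact absurd this (Fin.castSucc_lt_last i).ne
  · rw [genMinor, derivation_det, Finset.sum_eq_single (Fin.last r)]
    · rw [Matrix.det_succ_column _ (Fin.last r), Finset.sum_eq_single (Fin.last r)]
      · rw [Matrix.updateCol_self, genMinor]
        simp only [Matrix.of_apply, Fin.snoc_last, Fin.val_last, pderiv_X_self]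
        rw [← two_mul, pow_mul, neg_one_sq, one_pow, one_mul, one_mul]
        congr 1
        ext i k : 2
        simp
      · intro i _ hi
        obtain ⟨i, rfl⟩ := Fin.exists_castSucc_eq.mpr hi
        rw [Matrix.updateCol_self, Matrix.of_apply, Fin.snoc_castSucc, pderiv_X_of_ne]
        · simp
        · intro heq
          exact h (Finset.mem_image.mpr ⟨i, Finset.mem_univ _, congr_arg Prod.fst heq⟩)
      · simp
    · intro k _ hk
      refine Matrix.det_eq_zero_of_column_eq_zero k fun i => ?_
      rw [Matrix.updateCol_self, Matrix.of_apply, pderiv_X_of_ne]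
      intro heq
      exact hk (Fin.ext (congr_arg Prod.snd heq))
    · simp

open MvPolynomial in
theorem sum_pderiv_mul_genMinor_snoc {m r : ℕ} (b : Fin r → ℕ) (hb : ∀ i, b i < m)
    (g : MvPolynomial (ℕ × ℕ) ℂ) (μ : ℕ) (h0 : ∀ p < r, polarization m p r g = 0)
    (h1 : polarization m r r g = (μ : ℂ) • g) :
    ∑ a ∈ Finset.range m, pderiv (a, r) (g * genMinor (Fin.snoc b a : Fin (r + 1) → ℕ))
      = ((μ + (m - r) : ℕ) : ℂ) • (g * genMinor b) := by
  by_cases hinj : Function.Injective b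
  · have hcard : (Finset.univ.image b).card = r := by
      rw [Finset.card_image_of_injective _ hinj, Finset.card_univ, Fintype.card_fin]
    have hsub : Finset.univ.image b ⊆ Finset.range m := fun a ha => by
      obtain ⟨i, -, rfl⟩ := Finset.mem_image.mp ha
      exact Finset.mem_range.mpr (hb i)
    simp only [Derivation.leibniz, smul_eq_mul, pderiv_genMinor_snoc]
    rw [Finset.sum_add_distrib, sum_genMinor_snoc_mul_pderiv b g μ h0 h1, ← Finset.mul_sum,
      Finset.sum_ite, Finset.sum_const_zero, zero_add, Finset.sum_const,
      ← Finset.sdiff_eq_filter, Finset.card_sdiff_of_subset hsub, hcard, Finset.card_range,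
      ← Nat.cast_smul_eq_nsmul ℂ, mul_smul_comm, ← add_smul, ← Nat.cast_add, add_comm]
  · have hs : ∀ a, ¬ Function.Injective (Fin.snoc b a : Fin (r + 1) → ℕ) := fun a h =>
      hinj fun i j hij => Fin.castSucc_injective r (h (by simpa using hij))
    simp [genMinor_eq_zero hinj, genMinor_eq_zero (hs _)]

open MvPolynomial in
theorem fischer_genMinor_succ {m r : ℕ} (g h : MvPolynomial (ℕ × ℕ) ℂ) (μ : ℕ)
    (h0 : ∀ p < r, polarization m p r g = 0) (h1 : polarization m r r g = (μ : ℂ) • g) :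
    ∑ b : Fin (r + 1) → Fin m, fischer ((∏ j, X ((b j : ℕ), (j : ℕ))) * h)
        (g * genMinor fun i => (b i : ℕ))
      = ((μ + (m - r) : ℕ) : ℂ) * ∑ b : Fin r → Fin m,
        fischer ((∏ j, X ((b j : ℕ), (j : ℕ))) * h) (g * genMinor fun i => (b i : ℕ)) := by
  rw [← (Fin.snocEquiv fun _ : Fin (r + 1) => Fin m).sum_comp, Fintype.sum_prod_type,
    Finset.sum_comm, Finset.mul_sum]
  refine Finset.sum_congr rfl fun b _ => ?_
  have hs := sum_pderiv_mul_genMinor_snoc (fun i => (b i : ℕ)) (fun i => (b i).2) g μ h0 h1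
  rw [← smul_eq_mul, ← map_smul, ← hs, Finset.sum_range, map_sum]
  refine Finset.sum_congr rfl fun a _ => ?_
  rw [← fischer_X_mul]
  congr 2
  · simp [Fin.snocEquiv, Fin.prod_univ_castSucc]
    ring
  · congr 2
    funext i
    refine Fin.lastCases ?_ (fun i => ?_) i <;> simp [Fin.snocEquiv]

open MvPolynomial in
theorem fischer_genMinor {m : ℕ} (g h : MvPolynomial (ℕ × ℕ) ℂ) (μ : ℕ → ℕ)
    (h0 : ∀ p r, p < r → r < m → polarization m p r g = 0)
    (h1 : ∀ r < m, polarization m r r g = (μ r : ℂ) • g) (r : ℕ) (hr : r ≤ m) :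
    ∑ b : Fin r → Fin m, fischer ((∏ j, X ((b j : ℕ), (j : ℕ))) * h)
        (g * genMinor fun i => (b i : ℕ))
      = ((∏ i ∈ Finset.range r, (μ i + (m - i)) : ℕ) : ℂ) * fischer h g := by
  induction r with
  | zero => simp [genMinor]
  | succ r ih =>
    rw [fischer_genMinor_succ g h (μ r) (fun p hp => h0 p r hp hr) (h1 r hr),
      ih (by omega), Finset.prod_range_succ]
    push_cast
    ring

theorem genMinor_perm {m : ℕ} (τ : Equiv.Perm (Fin m)) :
    genMinor (fun i => (τ i : ℕ)) = ((Equiv.Perm.sign τ : ℤ) : MvPolynomial (ℕ × ℕ) ℂ) *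
      leadingMinor m := by
  rw [leadingMinor, genMinor, genMinor, ← Matrix.det_permute]
  rfl

open MvPolynomial in
theorem fischer_leadingMinor_mul {m : ℕ} (g h : MvPolynomial (ℕ × ℕ) ℂ) (μ : ℕ → ℕ)
    (h0 : ∀ p r, p < r → r < m → polarization m p r g = 0)
    (h1 : ∀ r < m, polarization m r r g = (μ r : ℂ) • g) :
    fischer (leadingMinor m * h) (leadingMinor m * g)
      = ((∏ i ∈ Finset.range m, (μ i + (m - i)) : ℕ) : ℂ) * fischer h g := by
  rw [← fischer_genMinor g h μ h0 h1 m le_rfl]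
  have hinj : Function.Injective fun τ : Equiv.Perm (Fin m) => (τ : Fin m → Fin m) :=
    DFunLike.coe_injective
  rw [← Finset.sum_subset (Finset.subset_univ (Finset.univ.image
    fun τ : Equiv.Perm (Fin m) => (τ : Fin m → Fin m))), Finset.sum_image hinj.injOn]
  · have hexp : leadingMinor m = ∑ τ : Equiv.Perm (Fin m),
        ((Equiv.Perm.sign τ : ℤ) : MvPolynomial (ℕ × ℕ) ℂ) * ∏ j, X ((τ j : ℕ), (j : ℕ)) := by
      rw [leadingMinor, genMinor, Matrix.det_apply']
      rfl
    nth_rw 1 [hexp]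
    rw [Finset.sum_mul, map_sum, LinearMap.sum_apply]
    refine Finset.sum_congr rfl fun τ _ => ?_
    rw [genMinor_perm, mul_assoc, mul_left_comm g, mul_comm g, ← zsmul_eq_mul, ← zsmul_eq_mul,
      map_zsmul, map_zsmul, LinearMap.smul_apply]
  · intro b _ hb
    rw [genMinor_eq_zero, mul_zero, map_zero]
    intro hi
    have hi' : Function.Injective b := fun i j hij => hi (congr_arg Fin.val hij)
    exact hb (Finset.mem_image.mpr
      ⟨Equiv.ofBijective b (Finite.injective_iff_bijective.mp hi'), Finset.mem_univ _, rfl⟩)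

theorem polarization_prod_leadingMinor {ι : Type*} {m p r : ℕ} (hpr : p ≤ r) (S : Finset ι)
    (ht : ι → ℕ) (hm : ∀ j ∈ S, ht j ≤ m) :
    polarization m p r (∏ j ∈ S, leadingMinor (ht j)) =
      ((if p = r then (S.filter fun j => r < ht j).card else 0 : ℕ) : ℂ) •
        ∏ j ∈ S, leadingMinor (ht j) := by
  classical
  induction S using Finset.induction_on with
  | empty => simp
  | insert a S ha ih =>
    rw [Finset.prod_insert ha, Derivation.leibniz, ih fun j hj => hm j (Finset.mem_insert_of_mem hj),
      polarization_leadingMinor (hm a (Finset.mem_insert_self _ _)) hpr, Finset.filter_insert]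
    by_cases hp : p = r
    · by_cases hr : r < ht a
      · have : a ∉ S.filter fun j => r < ht j := by simp [ha]
        simp [hp, hr, Finset.card_insert_of_notMem this, add_smul, mul_comm]
      · simp [hp, hr]
    · simp [hp]

theorem fischer_prod_leadingMinor (ht : ℕ → ℕ) (hanti : Antitone ht) (d k : ℕ) :
    fischer (∏ j ∈ Finset.Ico k (k + d), leadingMinor (ht j))
        (∏ j ∈ Finset.Ico k (k + d), leadingMinor (ht j))
      = ((∏ j ∈ Finset.Ico k (k + d), ∏ i ∈ Finset.range (ht j),
        (((Finset.Ico (j + 1) (k + d)).filter fun j' => i < ht j').card + (ht j - i)) : ℕ) : ℂ) := by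
  induction d generalizing k with
  | zero =>
    simpa using fischer_monomial_left (0 : ℕ × ℕ →₀ ℕ) 1
  | succ d ih =>
    have hk : k < k + (d + 1) := by omega
    have hd : k + (d + 1) = k + 1 + d := by omega
    rw [Finset.prod_eq_prod_Ico_succ_bot hk, Finset.prod_eq_prod_Ico_succ_bot hk,
      fischer_leadingMinor_mul _ _
        (fun r => ((Finset.Ico (k + 1) (k + (d + 1))).filter fun j => r < ht j).card), hd, ih]
    · push_cast
      rfl
    · intro p r hpr _
      rw [polarization_prod_leadingMinor hpr.le _ _ fun j hj => hanti (by grind), if_neg hpr.ne]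
      simp
    · intro r _
      rw [polarization_prod_leadingMinor le_rfl _ _ fun j hj => hanti (by grind), if_pos rfl]

theorem lt_getD_iff {s : List ℕ} (hs : s.Pairwise (· ≥ ·)) (i j : ℕ) :
    j < s.getD i 0 ↔ i < (s.filter fun p => j < p).length := by
  induction s generalizing i with
  | nil => simp
  | cons a s ih =>
    rw [List.pairwise_cons] at hs
    by_cases hj : j < a
    · cases i with
      | zero => simp [hj]
      | succ i =>
        rw [List.getD_cons_succ, ih hs.2, List.filter_cons_of_pos (by simpa using hj),
          List.length_cons, Nat.succ_lt_succ_iff]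
    · have : ∀ p ∈ s, ¬ j < p := fun p hp => by have := hs.1 p hp; omega
      have hnil : (s.filter fun p => decide (j < p)) = [] := by simpa using this
      cases i with
      | zero => simp [hj, hnil]
      | succ i => rw [List.getD_cons_succ, ih hs.2, List.filter_cons_of_neg (by simpa using hj),
          hnil, List.length_nil]; simp

theorem mem_cellsOf {s : List ℕ} (hs : s.Pairwise (· ≥ ·)) (c : ℕ × ℕ) :
    c ∈ cellsOf s ↔ c.2 < s.getD c.1 0 := by
  simp only [cellsOf, Finset.mem_filter, Finset.mem_product, Finset.mem_range,
    and_iff_right_iff_imp]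
  intro h
  refine ⟨?_, ?_⟩
  · by_contra hc
    rw [List.getD_eq_default _ _ (not_lt.mp hc)] at h
    omega
  · rw [lt_getD_iff hs] at h ⊢
    omega

theorem hookProd_eq {s : List ℕ} (hs : s.Pairwise (· ≥ ·)) :
    hookProd s = ∏ j ∈ Finset.range (s.getD 0 0),
      ∏ i ∈ Finset.range (s.filter fun p => j < p).length,
        (((Finset.Ico (j + 1) (s.getD 0 0)).filter
          fun j' => i < (s.filter fun p => j' < p).length).card +
            ((s.filter fun p => j < p).length - i)) := by
  rw [hookProd, Finset.prod_sigma']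
  refine Finset.prod_bij' (fun c _ => ⟨c.2, c.1⟩) (fun c _ => (c.2, c.1)) ?_ ?_ ?_ ?_ ?_
  · intro c hc
    have h := (mem_cellsOf hs c).mp hc
    rw [cellsOf] at hc
    simp only [Finset.mem_sigma, Finset.mem_range, ← lt_getD_iff hs]
    exact ⟨by grind, h⟩
  · rintro ⟨j, i⟩ hc
    simp only [Finset.mem_sigma, Finset.mem_range, ← lt_getD_iff hs] at hc
    exact (mem_cellsOf hs _).mpr hc.2
  · intros; rfl
  · intros; rfl
  · rintro ⟨i, j⟩ hc
    have h := (mem_cellsOf hs _).mp hc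
    have h' := (lt_getD_iff hs _ _).mp h
    have h0 : s.getD i 0 ≤ s.getD 0 0 := by
      by_contra hlt
      have := (lt_getD_iff hs _ _).mp (not_le.mp hlt)
      exact lt_irrefl _ ((lt_getD_iff hs 0 _).mpr (Nat.zero_lt_of_lt this))
    have : (Finset.Ico (j + 1) (s.getD 0 0)).filter
        (fun j' => i < (s.filter fun p => j' < p).length) = Finset.Ico (j + 1) (s.getD i 0) := by
      ext x
      simp only [Finset.mem_filter, Finset.mem_Ico, ← lt_getD_iff hs]
      omega
    simp only [this, Nat.card_Ico]
    simp only at h h'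
    omega

open MvPolynomial in
theorem prod_leadingMinor_eq_sum_colGroup {s : List ℕ} (hs : s.Pairwise (· ≥ ·)) :
    ∏ j ∈ Finset.range (s.getD 0 0), leadingMinor (s.filter fun p => j < p).length
      = ∑ σ ∈ colGroup s, (Equiv.Perm.sign σ : ℤ) •
        ∏ c : {c : ℕ × ℕ // c ∈ cellsOf s},
          (X ((σ c : ℕ × ℕ).1, (c : ℕ × ℕ).1) : MvPolynomial (ℕ × ℕ) ℂ) := by
  let A : Matrix {c : ℕ × ℕ // c ∈ cellsOf s} {c : ℕ × ℕ // c ∈ cellsOf s}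
      (MvPolynomial (ℕ × ℕ) ℂ) := Matrix.of fun c d =>
    if (c : ℕ × ℕ).2 = (d : ℕ × ℕ).2 then X ((c : ℕ × ℕ).1, (d : ℕ × ℕ).1) else 0
  have hA : A.BlockTriangular fun c => (c : ℕ × ℕ).2 := fun c d h => by
    simp only at h
    simp [A, h.ne']
  have hdet := hA.det
  have hblock : ∀ j, (A.toSquareBlock (fun c => (c : ℕ × ℕ).2) j).det
      = leadingMinor (s.filter fun p => j < p).length := by
    intro j
    let e : Fin (s.filter fun p => j < p).length ≃
        {c : {c : ℕ × ℕ // c ∈ cellsOf s} // (c : ℕ × ℕ).2 = j} :=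
      { toFun := fun i => ⟨⟨(i, j), (mem_cellsOf hs _).mpr ((lt_getD_iff hs _ _).mpr i.2)⟩, rfl⟩
        invFun := fun c => ⟨(c : ℕ × ℕ).1, by
          have := (lt_getD_iff hs _ _).mp ((mem_cellsOf hs _).mp c.1.2)
          rwa [c.2] at this⟩
        left_inv := fun i => rfl
        right_inv := fun c => by
          obtain ⟨⟨⟨i, j⟩, hc⟩, rfl⟩ := c
          rfl }
    rw [← Matrix.det_submatrix_equiv_self e, leadingMinor, genMinor]
    congr 1
    ext i k : 2
    simp [A, e, Matrix.toSquareBlock_def]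
  simp only [hblock] at hdet
  rw [← Finset.prod_subset (s₁ := Finset.univ.image
    fun c : {c : ℕ × ℕ // c ∈ cellsOf s} => (c : ℕ × ℕ).2), ← hdet, Matrix.det_apply]
  · rw [← Finset.sum_subset (Finset.subset_univ (colGroup s))]
    · refine Finset.sum_congr rfl fun σ hσ => ?_
      rw [colGroup, Finset.mem_filter_univ] at hσ
      simp [A, hσ, Units.smul_def]
    · intro σ _ hσ
      rw [colGroup, Finset.mem_filter_univ, not_forall] at hσ
      obtain ⟨c, hc⟩ := hσ
      rw [Finset.prod_eq_zero (Finset.mem_univ c), smul_zero]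
      simp [A, hc]
  · intro j hj
    obtain ⟨c, -, rfl⟩ := Finset.mem_image.mp hj
    have := (Finset.mem_filter.mp c.2).1
    exact (Finset.mem_product.mp this).2
  · intro j hj hj'
    exfalso
    refine hj' (Finset.mem_image.mpr ⟨⟨(0, j), ?_⟩, Finset.mem_univ _, rfl⟩)
    exact (mem_cellsOf hs _).mpr (Finset.mem_range.mp hj)

theorem sum_range_card_lt_sum {T : Finset ℕ} {t : ℕ} (ht : t ∈ T) (h : T.card ≤ t) :
    ∑ x ∈ Finset.range T.card, x < ∑ x ∈ T, x := by
  have h1 : (Finset.range T.card \ T).card = (T \ Finset.range T.card).card :=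
    Finset.card_sdiff_comm (by simp)
  have hpos : 0 < (T \ Finset.range T.card).card :=
    Finset.card_pos.mpr ⟨t, by simp [ht, h]⟩
  rw [← Finset.sum_sdiff_lt_sum_sdiff]
  calc ∑ x ∈ Finset.range T.card \ T, x
      < ∑ x ∈ Finset.range T.card \ T, T.card :=
        Finset.sum_lt_sum_of_nonempty (Finset.card_pos.mp (h1 ▸ hpos)) fun x hx => by
          simpa using (Finset.mem_sdiff.mp hx).1
    _ = ∑ x ∈ T \ Finset.range T.card, T.card := by simp [h1]
    _ ≤ ∑ x ∈ T \ Finset.range T.card, x :=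
        Finset.sum_le_sum fun x hx => by simpa using (Finset.mem_sdiff.mp hx).2

theorem sum_range_card_le_sum (T : Finset ℕ) : ∑ x ∈ Finset.range T.card, x ≤ ∑ x ∈ T, x := by
  by_cases h : ∃ t ∈ T, T.card ≤ t
  · obtain ⟨t, ht, h⟩ := h
    exact (sum_range_card_lt_sum ht h).le
  · push Not at h
    rw [← Finset.eq_of_subset_of_card_le (fun t ht => Finset.mem_range.mpr (h t ht)) (by simp)]

/-- If a permutation `g` of the cells sends distinct cells of one row to distinct columns, then
the cell in the row of `u` and the column of `g u` belongs to the diagram. -/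
theorem col_apply_lt {s : List ℕ} (hs : s.Pairwise (· ≥ ·))
    (g : Equiv.Perm {c : ℕ × ℕ // c ∈ cellsOf s})
    (hg : ∀ u v : {c : ℕ × ℕ // c ∈ cellsOf s},
      (u : ℕ × ℕ).1 = (v : ℕ × ℕ).1 → (g u : ℕ × ℕ).2 = (g v : ℕ × ℕ).2 → u = v)
    (u : {c : ℕ × ℕ // c ∈ cellsOf s}) : (g u : ℕ × ℕ).2 < s.getD (u : ℕ × ℕ).1 0 := by
  let row : ℕ → Finset {c : ℕ × ℕ // c ∈ cellsOf s} := fun i =>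
    Finset.univ.filter fun c => (c : ℕ × ℕ).1 = i
  have himg : ∀ i, (row i).image (fun c : {c : ℕ × ℕ // c ∈ cellsOf s} => (c : ℕ × ℕ).2)
      = Finset.range (s.getD i 0) := by
    intro i
    ext j
    simp only [row, Finset.mem_image, Finset.mem_filter_univ, Finset.mem_range]
    constructor
    · rintro ⟨c, rfl, rfl⟩
      exact (mem_cellsOf hs _).mp c.2
    · intro h
      exact ⟨⟨(i, j), (mem_cellsOf hs _).mpr h⟩, rfl, rfl⟩
  have hinj : ∀ i, Set.InjOn (fun c : {c : ℕ × ℕ // c ∈ cellsOf s} => (c : ℕ × ℕ).2) (row i) := by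
    intro i c hc d hd h
    simp only [row, Finset.coe_filter, Finset.mem_univ, true_and, Set.mem_ofPred_eq] at hc hd
    exact Subtype.ext (Prod.ext (hc.trans hd.symm) h)
  have hinjg : ∀ i, Set.InjOn (fun c => (g c : ℕ × ℕ).2) (row i) := by
    intro i c hc d hd h
    simp only [row, Finset.coe_filter, Finset.mem_univ, true_and, Set.mem_ofPred_eq] at hc hd
    exact hg c d (hc.trans hd.symm) h
  have hcard : ∀ i, ((row i).image fun c => (g c : ℕ × ℕ).2).card = s.getD i 0 := by
    intro i
    rw [Finset.card_image_of_injOn (hinjg i), ← Finset.card_image_of_injOn (hinj i), himg,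
      Finset.card_range]
  have hle : ∀ i, ∑ c ∈ row i, (c : ℕ × ℕ).2 ≤ ∑ c ∈ row i, (g c : ℕ × ℕ).2 := by
    intro i
    have := sum_range_card_le_sum ((row i).image fun c => (g c : ℕ × ℕ).2)
    rwa [hcard, ← himg, Finset.sum_image (hinj i), Finset.sum_image (hinjg i)] at this
  by_contra hu
  have hlt : ∑ c ∈ row (u : ℕ × ℕ).1, (c : ℕ × ℕ).2 <
      ∑ c ∈ row (u : ℕ × ℕ).1, (g c : ℕ × ℕ).2 := by
    have := sum_range_card_lt_sum (T := (row (u : ℕ × ℕ).1).image fun c => (g c : ℕ × ℕ).2)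
      (t := (g u : ℕ × ℕ).2) (Finset.mem_image_of_mem _ (by simp [row]))
      (by rw [hcard]; exact not_lt.mp hu)
    rwa [hcard, ← himg, Finset.sum_image (hinj _), Finset.sum_image (hinjg _)] at this
  have hsum := Finset.sum_lt_sum
    (s := Finset.univ.image fun c : {c : ℕ × ℕ // c ∈ cellsOf s} => (c : ℕ × ℕ).1)
    (fun i _ => hle i) ⟨_, Finset.mem_image_of_mem _ (Finset.mem_univ u), hlt⟩
  rw [Finset.sum_fiberwise_of_maps_to fun c _ => Finset.mem_image_of_mem _ (Finset.mem_univ c),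
    Finset.sum_fiberwise_of_maps_to fun c _ => Finset.mem_image_of_mem _ (Finset.mem_univ c),
    Equiv.sum_comp g fun c => (c : ℕ × ℕ).2] at hsum
  exact lt_irrefl _ hsum

theorem exists_eq_mul_of_injOn_rows {s : List ℕ} (hs : s.Pairwise (· ≥ ·))
    (g : Equiv.Perm {c : ℕ × ℕ // c ∈ cellsOf s})
    (hg : ∀ u v : {c : ℕ × ℕ // c ∈ cellsOf s},
      (u : ℕ × ℕ).1 = (v : ℕ × ℕ).1 → (g u : ℕ × ℕ).2 = (g v : ℕ × ℕ).2 → u = v) :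
    ∃ σ ∈ colGroup s, ∃ π ∈ rowGroup s, g = σ * π := by
  let f : {c : ℕ × ℕ // c ∈ cellsOf s} → {c : ℕ × ℕ // c ∈ cellsOf s} := fun u =>
    ⟨((u : ℕ × ℕ).1, (g u : ℕ × ℕ).2), (mem_cellsOf hs _).mpr (col_apply_lt hs g hg u)⟩
  have hf : Function.Injective f := fun u v h => by
    simp only [f, Subtype.mk.injEq, Prod.mk.injEq] at h
    exact hg u v h.1 h.2
  let π := Equiv.ofBijective f (Finite.injective_iff_bijective.mp hf)
  refine ⟨g * π⁻¹, ?_, π, ?_, by group⟩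
  · rw [colGroup, Finset.mem_filter_univ]
    intro c
    obtain ⟨u, rfl⟩ := π.surjective c
    rw [Equiv.Perm.mul_apply, Equiv.Perm.inv_def, Equiv.symm_apply_apply]
    rfl
  · rw [rowGroup, Finset.mem_filter_univ]
    exact fun c => rfl

theorem mul_mem_colGroup {s : List ℕ} {σ τ : Equiv.Perm {c : ℕ × ℕ // c ∈ cellsOf s}}
    (hσ : σ ∈ colGroup s) (hτ : τ ∈ colGroup s) : σ * τ ∈ colGroup s := by
  rw [colGroup, Finset.mem_filter_univ] at *
  exact fun c => (hσ _).trans (hτ c)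

theorem inv_mem_colGroup {s : List ℕ} {σ : Equiv.Perm {c : ℕ × ℕ // c ∈ cellsOf s}}
    (hσ : σ ∈ colGroup s) : σ⁻¹ ∈ colGroup s := by
  rw [colGroup, Finset.mem_filter_univ] at *
  intro c
  conv_rhs => rw [← σ.apply_symm_apply c, hσ]
  rfl

theorem mul_mem_rowGroup {s : List ℕ} {π τ : Equiv.Perm {c : ℕ × ℕ // c ∈ cellsOf s}}
    (hπ : π ∈ rowGroup s) (hτ : τ ∈ rowGroup s) : π * τ ∈ rowGroup s := by
  rw [rowGroup, Finset.mem_filter_univ] at *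
  exact fun c => (hπ _).trans (hτ c)

theorem inv_mem_rowGroup {s : List ℕ} {π : Equiv.Perm {c : ℕ × ℕ // c ∈ cellsOf s}}
    (hπ : π ∈ rowGroup s) : π⁻¹ ∈ rowGroup s := by
  rw [rowGroup, Finset.mem_filter_univ] at *
  intro c
  conv_rhs => rw [← π.apply_symm_apply c, hπ]
  rfl

theorem eq_of_coeff_one_eq {s : List ℕ} (hs : s.Pairwise (· ≥ ·))
    {x y : MonoidAlgebra ℂ (Equiv.Perm {c : ℕ × ℕ // c ∈ cellsOf s})}
    (hxc : ∀ σ ∈ colGroup s, MonoidAlgebra.single σ 1 * x = ((Equiv.Perm.sign σ : ℤ) : ℂ) • x)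
    (hxr : ∀ π ∈ rowGroup s, x * MonoidAlgebra.single π 1 = x)
    (hyc : ∀ σ ∈ colGroup s, MonoidAlgebra.single σ 1 * y = ((Equiv.Perm.sign σ : ℤ) : ℂ) • y)
    (hyr : ∀ π ∈ rowGroup s, y * MonoidAlgebra.single π 1 = y)
    (h1 : x.coeff 1 = y.coeff 1) : x = y := by
  suffices key : ∀ z : MonoidAlgebra ℂ (Equiv.Perm {c : ℕ × ℕ // c ∈ cellsOf s}),
      (∀ σ ∈ colGroup s, MonoidAlgebra.single σ 1 * z = ((Equiv.Perm.sign σ : ℤ) : ℂ) • z) →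
      (∀ π ∈ rowGroup s, z * MonoidAlgebra.single π 1 = z) → z.coeff 1 = 0 → z = 0 by
    refine sub_eq_zero.mp (key (x - y) (fun σ hσ => ?_) (fun π hπ => ?_) ?_)
    · rw [mul_sub, hxc σ hσ, hyc σ hσ, smul_sub]
    · rw [sub_mul, hxr π hπ, hyr π hπ]
    · rw [MonoidAlgebra.coeff_sub, Finsupp.sub_apply, h1, sub_self]
  intro z hc hr h1
  have hc' : ∀ σ ∈ colGroup s, ∀ g, z.coeff (σ⁻¹ * g) = ((Equiv.Perm.sign σ : ℤ) : ℂ) * z.coeff g :=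
    fun σ hσ g => by
      have := congr_arg (fun w => w.coeff g) (hc σ hσ)
      simpa using this
  have hr' : ∀ π ∈ rowGroup s, ∀ g, z.coeff (g * π⁻¹) = z.coeff g := fun π hπ g => by
    have := congr_arg (fun w => w.coeff g) (hr π hπ)
    simpa using this
  ext g
  rw [MonoidAlgebra.coeff_zero, Finsupp.zero_apply]
  by_cases hg : ∀ u v : {c : ℕ × ℕ // c ∈ cellsOf s},
      (u : ℕ × ℕ).1 = (v : ℕ × ℕ).1 → (g u : ℕ × ℕ).2 = (g v : ℕ × ℕ).2 → u = v
  · obtain ⟨σ, hσ, π, hπ, rfl⟩ := exists_eq_mul_of_injOn_rows hs g hg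
    have h2 := hc' σ⁻¹ (inv_mem_colGroup hσ) 1
    have h3 := hr' π⁻¹ (inv_mem_rowGroup hπ) σ
    rw [inv_inv] at h3
    rw [h3]
    simpa [h1] using h2
  · push Not at hg
    obtain ⟨u, v, huv, hguv, hne⟩ := hg
    have hσ : Equiv.swap (g u) (g v) ∈ colGroup s := by
      rw [colGroup, Finset.mem_filter_univ]
      intro c
      rw [Equiv.swap_apply_def]
      split_ifs with h h' <;> simp_all
    have hπ : Equiv.swap u v ∈ rowGroup s := by
      rw [rowGroup, Finset.mem_filter_univ]
      intro c
      rw [Equiv.swap_apply_def]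
      split_ifs with h h' <;> simp_all
    have h2 := hc' _ hσ g
    have h3 := hr' _ hπ g
    rw [Equiv.swap_inv, Equiv.swap_mul_eq_mul_swap] at h2
    rw [Equiv.swap_inv] at h3
    simp only [Equiv.Perm.inv_def, Equiv.symm_apply_apply, h3,
      Equiv.Perm.sign_swap (g.injective.ne hne)] at h2
    have h4 : z.coeff g = -z.coeff g := by simpa using h2
    exact self_eq_neg.mp h4

theorem single_mul_youngSymmetrizer {s : List ℕ}
    {τ : Equiv.Perm {c : ℕ × ℕ // c ∈ cellsOf s}} (hτ : τ ∈ colGroup s) :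
    MonoidAlgebra.single τ 1 * youngSymmetrizer s
      = ((Equiv.Perm.sign τ : ℤ) : ℂ) • youngSymmetrizer s := by
  rw [youngSymmetrizer, Finset.mul_sum, Finset.smul_sum]
  refine Finset.sum_bij' (fun σ _ => τ * σ) (fun σ _ => τ⁻¹ * σ)
    (fun σ hσ => mul_mem_colGroup hτ hσ) (fun σ hσ => mul_mem_colGroup (inv_mem_colGroup hτ) hσ)
    (fun _ _ => inv_mul_cancel_left _ _) (fun _ _ => mul_inv_cancel_left _ _) fun σ _ => ?_
  rw [Finset.mul_sum, Finset.smul_sum]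
  refine Finset.sum_congr rfl fun π _ => ?_
  rw [mul_smul_comm, MonoidAlgebra.single_mul_single, one_mul, smul_smul, Equiv.Perm.sign_mul,
    mul_assoc]
  congr 1
  have : ((Equiv.Perm.sign τ : ℤ) : ℂ) * ((Equiv.Perm.sign τ : ℤ) : ℂ) = 1 := by
    rw [← Int.cast_mul, ← Units.val_mul, Int.units_mul_self]
    simp
  rw [Units.val_mul, Int.cast_mul, ← mul_assoc, this, one_mul]

theorem youngSymmetrizer_mul_single {s : List ℕ}
    {τ : Equiv.Perm {c : ℕ × ℕ // c ∈ cellsOf s}} (hτ : τ ∈ rowGroup s) :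
    youngSymmetrizer s * MonoidAlgebra.single τ 1 = youngSymmetrizer s := by
  rw [youngSymmetrizer, Finset.sum_mul]
  refine Finset.sum_congr rfl fun σ _ => ?_
  rw [Finset.sum_mul]
  refine Finset.sum_bij' (fun π _ => π * τ) (fun π _ => π * τ⁻¹)
    (fun π hπ => mul_mem_rowGroup hπ hτ) (fun π hπ => mul_mem_rowGroup hπ (inv_mem_rowGroup hτ))
    (fun _ _ => mul_inv_cancel_right _ _) (fun _ _ => inv_mul_cancel_right _ _) fun π _ => ?_
  rw [smul_mul_assoc, MonoidAlgebra.single_mul_single, one_mul, mul_assoc]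

theorem coeff_one_youngSymmetrizer (s : List ℕ) : (youngSymmetrizer s).coeff 1 = 1 := by
  classical
  have hc : (1 : Equiv.Perm {c : ℕ × ℕ // c ∈ cellsOf s}) ∈ colGroup s := by simp [colGroup]
  have hr : (1 : Equiv.Perm {c : ℕ × ℕ // c ∈ cellsOf s}) ∈ rowGroup s := by simp [rowGroup]
  simp only [youngSymmetrizer, MonoidAlgebra.coeff_sum, MonoidAlgebra.coeff_smul,
    Finsupp.finsetSum_apply, Finsupp.smul_apply, MonoidAlgebra.coeff_single, Finsupp.single_apply]
  have hone : ∀ σ ∈ colGroup s, ∀ π ∈ rowGroup s, σ * π = 1 → σ = 1 ∧ π = 1 := by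
    intro σ hσ π hπ h
    have hπ' : π = 1 := by
      have hcol : π ∈ colGroup s := by
        rw [← inv_eq_of_mul_eq_one_right h]
        exact inv_mem_colGroup hσ
      rw [rowGroup, Finset.mem_filter_univ] at hπ
      rw [colGroup, Finset.mem_filter_univ] at hcol
      exact Equiv.ext fun c => Subtype.ext (Prod.ext (hπ c) (hcol c))
    exact ⟨by simpa [hπ'] using h, hπ'⟩
  rw [Finset.sum_eq_single_of_mem 1 hc, Finset.sum_eq_single_of_mem 1 hr]
  · simp
  · intro π hπ hne
    rw [if_neg fun h => hne (hone 1 hc π hπ h).2, smul_zero]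
  · intro σ hσ hne
    refine Finset.sum_eq_zero fun π hπ => ?_
    rw [if_neg fun h => hne (hone σ hσ π hπ h).1, smul_zero]

open MvPolynomial in
theorem coeff_one_youngSymmetrizer_mul_self {s : List ℕ} (hs : s.Pairwise (· ≥ ·)) :
    (youngSymmetrizer s * youngSymmetrizer s).coeff 1 = hookProd s := by
  classical
  have h := fischer_prod_leadingMinor (fun j => (s.filter fun p => j < p).length)
    (fun j k hjk => (List.monotone_filter_right s (by intro a; grind)).length_le)
    (s.getD 0 0) 0
  rw [zero_add, ← Finset.range_eq_Ico, ← hookProd_eq hs, prod_leadingMinor_eq_sum_colGroup hs] at h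
  rw [← h, LinearMap.map_sum₂]
  simp only [youngSymmetrizer, Finset.sum_mul]
  simp only [Finset.mul_sum, MonoidAlgebra.coeff_sum, Finsupp.finsetSum_apply]
  refine Finset.sum_congr rfl fun σ _ => ?_
  rw [map_sum, Finset.sum_comm]
  refine Finset.sum_bij' (fun τ _ => τ⁻¹) (fun τ _ => τ⁻¹) (fun _ h => inv_mem_colGroup h)
    (fun _ h => inv_mem_colGroup h) (fun _ _ => inv_inv _) (fun _ _ => inv_inv _) fun τ _ => ?_
  rw [map_zsmul, map_zsmul, LinearMap.smul_apply, fischer_prod_X, Finset.card_filter]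
  simp only [smul_mul_smul_comm, MonoidAlgebra.single_mul_single, MonoidAlgebra.coeff_smul,
    Finsupp.smul_apply, MonoidAlgebra.coeff_single, Finsupp.single_apply, ← Finset.smul_sum,
    mul_one, Equiv.Perm.sign_inv]
  rw [smul_smul, ← Int.cast_smul_eq_zsmul ℂ, mul_comm (Equiv.Perm.sign τ : ℤ), Int.cast_mul]
  congr 1
  push_cast
  rw [← Finset.sum_subset (Finset.subset_univ (rowGroup s))]
  · refine Finset.sum_congr rfl fun π hπ => ?_
    have hiff : ∀ π', σ * π * (τ * π') = 1 ↔ π' = (σ * π * τ)⁻¹ := fun π' => by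
      rw [← mul_assoc, mul_eq_one_iff_eq_inv']
    simp only [hiff, Finset.sum_ite_eq']
    refine if_congr ⟨fun hmem c => ?_, fun hcond => inv_mem_rowGroup ?_⟩ rfl rfl
    · have hmem := inv_mem_rowGroup hmem
      rw [rowGroup, Finset.mem_filter_univ] at hmem hπ
      have := hmem (τ⁻¹ c)
      rw [inv_inv, Equiv.Perm.mul_apply, Equiv.Perm.inv_def, Equiv.apply_symm_apply] at this
      exact Prod.ext this (hπ c)
    · rw [rowGroup, Finset.mem_filter_univ]
      intro c
      have := congr_arg Prod.fst (hcond (τ c))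
      rwa [Equiv.Perm.inv_def, Equiv.symm_apply_apply] at this
  · intro π _ hπ
    rw [if_neg]
    intro h
    refine hπ ?_
    rw [rowGroup, Finset.mem_filter_univ]
    exact fun c => congr_arg Prod.snd (h c)

/-- The Young symmetrizer satisfies `c_λ · c_λ = hook(λ) · c_λ`, where `hook(λ)` is the
product of the hook lengths of `λ`. -/
theorem youngSymmetrizer_mul_self (n : ℕ) (p : n.Partition) :
    youngSymmetrizer (partsList p) * youngSymmetrizer (partsList p)
      = (hookProd (partsList p) : ℂ) • youngSymmetrizer (partsList p) := by
  have hs : (partsList p).Pairwise (· ≥ ·) := Multiset.pairwise_sort _ _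
  refine eq_of_coeff_one_eq hs (fun σ hσ => ?_) (fun π hπ => ?_) (fun σ hσ => ?_)
    (fun π hπ => ?_) ?_
  · rw [← mul_assoc, single_mul_youngSymmetrizer hσ, smul_mul_assoc]
  · rw [mul_assoc, youngSymmetrizer_mul_single hπ]
  · rw [mul_smul_comm, single_mul_youngSymmetrizer hσ, smul_comm]
  · rw [smul_mul_assoc, youngSymmetrizer_mul_single hπ]
  · rw [coeff_one_youngSymmetrizer_mul_self hs, MonoidAlgebra.coeff_smul, Finsupp.smul_apply,
      coeff_one_youngSymmetrizer, smul_eq_mul, mul_one]
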